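/- Let X be a connected and locally connected topological space. Then X has the Phragmen–Brouwer Property I if and only if X has the Phragmen–Brouwer Property I′. That is: (for all disjoint closed subsets D, E of X and all points a, b ∈ X \ (D ∪ E), if neither D nor E separates a and b then D ∪ E does not separate a and b) if and only if (for all disjoint closed subsets D, E of X, if neither D nor E separates X then D ∪ E does not separate X). -/

import Mathlib

/-- `D` separates the space `X`: the complement of `D` has more than one
connected component. -/
def SeparatesSpace {X : Type} [TopologicalSpace X] (D : Set X) : Prop :=
  ∃ a ∈ Dᶜ, ∃ b ∈ Dᶜ, b ∉ connectedComponentIn Dᶜ a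

theorem IsPreconnected.mem_connectedComponentIn_of_mem_closure {X : Type*} [TopologicalSpace X]
    {S F : Set X} {x y : X} (hS : IsPreconnected S) (hx : x ∈ S) (hSF : S ⊆ F)
    (hy : y ∈ closure S) (hyF : y ∈ F) : y ∈ _root_.connectedComponentIn F x := by
  have h : IsPreconnected (insert y S) :=
    hS.subset_closure (Set.subset_insert y S) (Set.insert_subset hy subset_closure)
  exact h.subset_connectedComponentIn (Set.mem_insert_of_mem y hx)
    (Set.insert_subset hyF hSF) (Set.mem_insert y S)

theorem frontier_connectedComponentIn_subset_compl {X : Type*} [TopologicalSpace X]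
    [LocallyConnectedSpace X] {U : Set X} (hU : IsOpen U) {x : X} (hx : x ∈ U) :
    frontier (connectedComponentIn U x) ⊆ Uᶜ := by
  intro y hy hyU
  rw [hU.connectedComponentIn.frontier_eq] at hy
  exact hy.2 (isPreconnected_connectedComponentIn.mem_connectedComponentIn_of_mem_closure
    (mem_connectedComponentIn hx) (connectedComponentIn_subset U x) hy.1 hyU)

theorem not_separatesSpace_of_isPreconnected_compl {X : Type} [TopologicalSpace X] {D : Set X}
    (h : IsPreconnected Dᶜ) : ¬ SeparatesSpace D := by
  rintro ⟨a, ha, b, hb, hab⟩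
  exact hab (h.subset_connectedComponentIn ha subset_rfl hb)

/-- If the frontier of a connected set `A` is covered by `D'` and `E'`, then the components of
`a ∈ A` in the complements of `D'` and `E'` cover the whole space. -/
theorem connectedComponentIn_union_eq_univ_of_frontier_eq {X : Type*} [TopologicalSpace X]
    [ConnectedSpace X] [LocallyConnectedSpace X] {A D' E' : Set X} {a : X}
    (hA : IsPreconnected A) (hAo : IsOpen A) (ha : a ∈ A) (hne : (frontier A).Nonempty)
    (hC : frontier A = D' ∪ E') (hd : Disjoint D' E') :
    connectedComponentIn D'ᶜ a ∪ connectedComponentIn E'ᶜ a = Set.univ := by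
  have hAC : Disjoint A (D' ∪ E') := hC ▸ (disjoint_frontier_iff_isOpen.2 hAo).symm
  have hCA : D' ∪ E' ⊆ closure A := hC ▸ frontier_subset_closure
  have hE : ∀ y ∈ E', y ∈ connectedComponentIn D'ᶜ a := fun y hy =>
    hA.mem_connectedComponentIn_of_mem_closure ha
      (fun z hz hzD => hAC.le_bot ⟨hz, Or.inl hzD⟩) (hCA (Or.inr hy))
      (fun hyD => hd.le_bot ⟨hyD, hy⟩)
  have hD : ∀ y ∈ D', y ∈ connectedComponentIn E'ᶜ a := fun y hy =>
    hA.mem_connectedComponentIn_of_mem_closure ha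
      (fun z hz hzE => hAC.le_bot ⟨hz, Or.inr hzE⟩) (hCA (Or.inl hy))
      (fun hyE => hd.le_bot ⟨hy, hyE⟩)
  refine Set.eq_univ_of_forall fun x => ?_
  by_cases hx : x ∈ D' ∪ E'
  · exact hx.elim (fun h => Or.inr (hD x h)) (fun h => Or.inl (hE x h))
  set W := connectedComponentIn (D' ∪ E')ᶜ x
  have hWC : W ⊆ (D' ∪ E')ᶜ := connectedComponentIn_subset _ _
  have hxW : x ∈ W := mem_connectedComponentIn hx
  have hWn : (frontier W).Nonempty := by
    refine nonempty_frontier_iff.2 ⟨⟨x, hxW⟩, fun h => ?_⟩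
    obtain ⟨c, hc⟩ := hC ▸ hne
    exact hWC (h ▸ Set.mem_univ c) hc
  obtain ⟨c, hc⟩ := hWn
  have hopen : IsOpen (D' ∪ E')ᶜ := (hC ▸ isClosed_frontier : IsClosed (D' ∪ E')).isOpen_compl
  have hcC : c ∈ D' ∪ E' :=
    Set.notMem_compl_iff.1 (frontier_connectedComponentIn_subset_compl hopen hx hc)
  have hcW : c ∈ closure W := frontier_subset_closure hc
  have hWpre : IsPreconnected W := isPreconnected_connectedComponentIn
  rcases hcC with h | h
  · right
    have hcx := hWpre.mem_connectedComponentIn_of_mem_closure (F := E'ᶜ) hxW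
      (fun z hz hzE => hWC hz (Or.inr hzE)) hcW (fun hcE => hd.le_bot ⟨h, hcE⟩)
    rw [connectedComponentIn_eq (hD c h), ← connectedComponentIn_eq hcx]
    exact mem_connectedComponentIn fun hxE => hx (Or.inr hxE)
  · left
    have hcx := hWpre.mem_connectedComponentIn_of_mem_closure (F := D'ᶜ) hxW
      (fun z hz hzD => hWC hz (Or.inl hzD)) hcW (fun hcD => hd.le_bot ⟨hcD, h⟩)
    rw [connectedComponentIn_eq (hE c h), ← connectedComponentIn_eq hcx]
    exact mem_connectedComponentIn fun hxD => hx (Or.inl hxD)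

/-- **(Wilder).** For a connected, locally connected space the Phragmen–Brouwer
properties I and I′ are equivalent. -/
theorem PBI_iff_PBI'
    {X : Type} [TopologicalSpace X] [ConnectedSpace X] [LocallyConnectedSpace X] :
    (∀ D E : Set X, IsClosed D → IsClosed E → Disjoint D E →
      ∀ a b : X, a ∉ D ∪ E → b ∉ D ∪ E →
        b ∈ connectedComponentIn Dᶜ a → b ∈ connectedComponentIn Eᶜ a →
        b ∈ connectedComponentIn (D ∪ E)ᶜ a) ↔
    (∀ D E : Set X, IsClosed D → IsClosed E → Disjoint D E →
      ¬ SeparatesSpace D → ¬ SeparatesSpace E → ¬ SeparatesSpace (D ∪ E)) := by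
  constructor
  · rintro h D E hD hE hd hsD hsE ⟨a, ha, b, hb, hab⟩
    refine hab (h D E hD hE hd a b ha hb ?_ ?_)
    · by_contra hn
      exact hsD ⟨a, fun h => ha (Or.inl h), b, fun h => hb (Or.inl h), hn⟩
    · by_contra hn
      exact hsE ⟨a, fun h => ha (Or.inr h), b, fun h => hb (Or.inr h), hn⟩
  · intro h D E hD hE hd a b ha hb hbD hbE
    by_contra hab
    have hopen : IsOpen (D ∪ E)ᶜ := (hD.union hE).isOpen_compl
    set A := connectedComponentIn (D ∪ E)ᶜ a
    have haA : a ∈ A := mem_connectedComponentIn ha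
    have hA : IsPreconnected A := isPreconnected_connectedComponentIn
    have hAo : IsOpen A := hopen.connectedComponentIn
    have hC : frontier A = frontier A ∩ D ∪ frontier A ∩ E := by
      rw [← Set.inter_union_distrib_left, eq_comm, Set.inter_eq_left, ← compl_compl (D ∪ E)]
      exact frontier_connectedComponentIn_subset_compl hopen ha
    have hne : (frontier A).Nonempty :=
      nonempty_frontier_iff.2 ⟨⟨a, haA⟩, fun hu => hab (hu ▸ Set.mem_univ b)⟩
    have hcover := connectedComponentIn_union_eq_univ_of_frontier_eq hA hAo haA hne hC
      (hd.mono Set.inter_subset_right Set.inter_subset_right)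
    have hPo : IsOpen (connectedComponentIn (frontier A ∩ D)ᶜ a) :=
      (isClosed_frontier.inter hD).isOpen_compl.connectedComponentIn
    have hQo : IsOpen (connectedComponentIn (frontier A ∩ E)ᶜ a) :=
      (isClosed_frontier.inter hE).isOpen_compl.connectedComponentIn
    have haP : a ∈ connectedComponentIn (frontier A ∩ D)ᶜ a :=
      mem_connectedComponentIn fun h => ha (Or.inl h.2)
    have haQ : a ∈ connectedComponentIn (frontier A ∩ E)ᶜ a :=
      mem_connectedComponentIn fun h => ha (Or.inr h.2)
    have hbP : b ∈ connectedComponentIn (frontier A ∩ D)ᶜ a :=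
      connectedComponentIn_mono a (Set.compl_subset_compl.2 Set.inter_subset_right) hbD
    have hbQ : b ∈ connectedComponentIn (frontier A ∩ E)ᶜ a :=
      connectedComponentIn_mono a (Set.compl_subset_compl.2 Set.inter_subset_right) hbE
    have hPD := connectedComponentIn_subset (frontier A ∩ D)ᶜ a
    have hQE := connectedComponentIn_subset (frontier A ∩ E)ᶜ a
    have hPc : IsPreconnected (connectedComponentIn (frontier A ∩ D)ᶜ a) :=
      isPreconnected_connectedComponentIn
    have hQc : IsPreconnected (connectedComponentIn (frontier A ∩ E)ᶜ a) :=
      isPreconnected_connectedComponentIn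
    generalize connectedComponentIn (frontier A ∩ D)ᶜ a = P at *
    generalize connectedComponentIn (frontier A ∩ E)ᶜ a = Q at *
    refine h Pᶜ Qᶜ hPo.isClosed_compl hQo.isClosed_compl ?_
      (not_separatesSpace_of_isPreconnected_compl (by rwa [compl_compl]))
      (not_separatesSpace_of_isPreconnected_compl (by rwa [compl_compl])) ?_
    · rw [Set.disjoint_iff_inter_eq_empty, ← Set.compl_union, hcover, Set.compl_univ]
    · rw [← Set.compl_inter]
      refine ⟨a, by simpa using ⟨haP, haQ⟩, b, by simpa using ⟨hbP, hbQ⟩, fun hb' => hab ?_⟩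
      rw [compl_compl] at hb'
      refine isPreconnected_connectedComponentIn.subset_of_closure_inter_subset hAo
        ⟨a, mem_connectedComponentIn (Set.mem_inter haP haQ), haA⟩ ?_ hb'
      rintro z ⟨hzA, hz⟩
      by_contra hzn
      have hzC : z ∈ frontier A := hAo.frontier_eq ▸ ⟨hzA, hzn⟩
      have hzPQ := connectedComponentIn_subset _ _ hz
      exact (hC ▸ hzC).elim (hPD hzPQ.1) (hQE hzPQ.2)
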